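/- Let 0 < R⊕ < R_s and let x, y be points in Euclidean 3-space with ‖x‖ = ‖y‖ = R_s. Then every point of the closed segment from x to y has norm at least R⊕ (i.e. the link between x and y is not blocked by the ball of radius R⊕ centered at the origin) if and only if ‖x − y‖ ≤ 2√(R_s² − R⊕²). -/

import Mathlib

open Real

theorem link_not_blocked_iff_chord_le
    (REarth Rs : ℝ) (hE : 0 < REarth) (hER : REarth < Rs)
    (x y : EuclideanSpace ℝ (Fin 3)) (hx : ‖x‖ = Rs) (hy : ‖y‖ = Rs) :
    (∀ p ∈ segment ℝ x y, REarth ≤ ‖p‖) ↔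
      ‖x - y‖ ≤ 2 * Real.sqrt (Rs ^ 2 - REarth ^ 2) := by
  have key : ∀ a b : ℝ, a + b = 1 →
      ‖a • x + b • y‖ ^ 2 = Rs ^ 2 - a * b * ‖x - y‖ ^ 2 := by
    intro a b hab
    rw [norm_add_sq_real, norm_sub_sq_real, norm_smul, norm_smul, real_inner_smul_left,
      real_inner_smul_right, mul_pow, mul_pow, hx, hy, Real.norm_eq_abs, Real.norm_eq_abs,
      sq_abs, sq_abs]
    obtain rfl : b = 1 - a := by linarith
    ring
  have hpos : 0 ≤ Rs ^ 2 - REarth ^ 2 := by nlinarith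
  have hs := Real.sq_sqrt hpos
  have hs0 := Real.sqrt_nonneg (Rs ^ 2 - REarth ^ 2)
  constructor
  · intro h
    have h1 := h ((1 / 2 : ℝ) • x + (1 / 2 : ℝ) • y)
      ⟨1 / 2, 1 / 2, by norm_num, by norm_num, by norm_num, rfl⟩
    have h2 := key (1 / 2) (1 / 2) (by norm_num)
    have h3 := pow_le_pow_left₀ hE.le h1 2
    refine (pow_le_pow_iff_left₀ (by positivity) (by positivity) two_ne_zero).1 ?_
    rw [mul_pow, hs]
    linarith
  · rintro h p ⟨a, b, ha, hb, hab, rfl⟩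
    have h2 := key a b hab
    have h3 := pow_le_pow_left₀ (norm_nonneg _) h 2
    rw [mul_pow, hs] at h3
    have h4 : a * b ≤ 1 / 4 := by
      obtain rfl : b = 1 - a := by linarith
      nlinarith [sq_nonneg (a - 1 / 2)]
    have h5 := mul_le_mul_of_nonneg_right h4 (sq_nonneg ‖x - y‖)
    refine (pow_le_pow_iff_left₀ (by positivity) (norm_nonneg _) two_ne_zero).1 ?_
    linarith
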